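/- arXiv:2006.04673 — 4 statements merged into one kernel-verified Lean document; each statement's English description precedes it below -/
import Mathlib

section
/- In the representation of the Boolean algebra of conditionals, the defining identities (C1)-(C5) hold: for all events A, C ⊆ Ω and all nonempty events B, D ⊆ Ω, (i) ⟦B∣B⟧ is the set of all enumerations of Ω; (ii) ⟦A∣B⟧ ∩ ⟦C∣B⟧ = ⟦A∩C∣B⟧; (iii) the complement of ⟦A∣B⟧ within the set of all enumerations equals ⟦Ω∖A∣B⟧; (iv) ⟦A∩B∣B⟧ = ⟦A∣B⟧; (v) if A ⊆ B ⊆ D then ⟦A∣B⟧ ∩ ⟦B∣D⟧ = ⟦A∣D⟧. -/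
open Finset

variable {Ω : Type*}

noncomputable def sigmaFirst [Fintype Ω] [DecidableEq Ω] [Nonempty Ω]
    (σ : Fin (Fintype.card Ω) ≃ Ω) (B : Finset Ω) : Ω :=
  if h : (Finset.univ.filter fun i => σ i ∈ B).Nonempty then
    σ ((Finset.univ.filter fun i => σ i ∈ B).min' h)
  else Classical.arbitrary Ω

def condEvent [Fintype Ω] [DecidableEq Ω] [Nonempty Ω]
    (A B : Finset Ω) : Set (Fin (Fintype.card Ω) ≃ Ω) :=
  {σ | sigmaFirst σ B ∈ A}

section SigmaFirst

variable [Fintype Ω] [DecidableEq Ω] [Nonempty Ω] (σ : Fin (Fintype.card Ω) ≃ Ω)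

theorem sigmaFirst_mem {B : Finset Ω} (hB : B.Nonempty) : sigmaFirst σ B ∈ B := by
  have h : (Finset.univ.filter fun i => σ i ∈ B).Nonempty := by
    obtain ⟨b, hb⟩ := hB
    exact ⟨σ.symm b, by simpa using hb⟩
  rw [sigmaFirst, dif_pos h]
  exact (Finset.mem_filter.mp (Finset.min'_mem _ h)).2

theorem symm_sigmaFirst_le {B : Finset Ω} {b : Ω} (hb : b ∈ B) :
    σ.symm (sigmaFirst σ B) ≤ σ.symm b := by
  have hmem : σ.symm b ∈ Finset.univ.filter fun i => σ i ∈ B := by simpa using hb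
  rw [sigmaFirst, dif_pos ⟨_, hmem⟩, Equiv.symm_apply_apply]
  exact Finset.min'_le _ _ hmem

theorem sigmaFirst_eq_of_subset {B D : Finset Ω} (hBD : B ⊆ D) (h : sigmaFirst σ D ∈ B) :
    sigmaFirst σ B = sigmaFirst σ D :=
  σ.symm.injective <| le_antisymm (symm_sigmaFirst_le σ h)
    (symm_sigmaFirst_le σ (hBD (sigmaFirst_mem σ ⟨_, h⟩)))

end SigmaFirst

theorem stmt0 [Fintype Ω] [DecidableEq Ω] [Nonempty Ω]
    (A C B D : Finset Ω) (hB : B.Nonempty) (hD : D.Nonempty) :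
    condEvent B B = (Set.univ : Set (Fin (Fintype.card Ω) ≃ Ω)) ∧
    condEvent A B ∩ condEvent C B = condEvent (A ∩ C) B ∧
    (condEvent A B)ᶜ = condEvent (Finset.univ \ A) B ∧
    condEvent (A ∩ B) B = condEvent A B ∧
    (A ⊆ B → B ⊆ D → condEvent A B ∩ condEvent B D = condEvent A D) := by
  refine ⟨?_, ?_, ?_, ?_, fun hAB hBD => ?_⟩
  · exact Set.eq_univ_of_forall fun σ => sigmaFirst_mem σ hB
  · ext σ
    simp [condEvent]
  · ext σ
    simp [condEvent]
  · ext σ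
    simp [condEvent, sigmaFirst_mem σ hB]
  · ext σ
    constructor
    · rintro ⟨hA, hD'⟩
      exact (sigmaFirst_eq_of_subset σ hBD hD' ▸ hA : sigmaFirst σ D ∈ A)
    · intro hA
      have hD' : sigmaFirst σ D ∈ B := hAB hA
      exact ⟨(sigmaFirst_eq_of_subset σ hBD hD' ▸ hA : sigmaFirst σ B ∈ A), hD'⟩
end

section
/- For each 1 ≤ i ≤ n−1 and each tuple ⟨a₁,…,a_i⟩ of pairwise distinct elements of Ω, let ω⟨a₁,…,a_i⟩ := ⋂_{k=1}^{i} ⟦{a_k} ∣ Ω∖{a₁,…,a_{k−1}}⟧. Then, for each fixed i, the family of all sets ω⟨a₁,…,a_i⟩, as ⟨a₁,…,a_i⟩ ranges over all tuples of i pairwise distinct elements of Ω, is a partition of the set of all enumerations of Ω: each such set is nonempty, distinct tuples yield disjoint sets, and their union is the set of all enumerations. -/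
open Finset

variable {Ω : Type*}

def omegaSet [Fintype Ω] [DecidableEq Ω] [Nonempty Ω] {i : ℕ} (a : Fin i → Ω) :
    Set (Fin (Fintype.card Ω) ≃ Ω) :=
  ⋂ k : Fin i,
    condEvent {a k} (Finset.univ \ (Finset.univ.filter fun j : Fin i => j < k).image a)

theorem sigmaFirst_eq_of_forall_lt [Fintype Ω] [DecidableEq Ω] [Nonempty Ω]
    (σ : Fin (Fintype.card Ω) ≃ Ω) (B : Finset Ω) (p : Fin (Fintype.card Ω))
    (hp : σ p ∈ B) (hlt : ∀ q < p, σ q ∉ B) : sigmaFirst σ B = σ p := by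
  have hmem : p ∈ Finset.univ.filter fun i => σ i ∈ B := by simpa using hp
  rw [sigmaFirst, dif_pos ⟨p, hmem⟩]
  congr 1
  refine le_antisymm (Finset.min'_le _ _ hmem) (Finset.le_min' _ _ _ fun q hq => ?_)
  by_contra! h
  exact hlt q h (Finset.mem_filter.mp hq).2

theorem sigmaFirst_sdiff_image_of_agree [Fintype Ω] [DecidableEq Ω] [Nonempty Ω] {i : ℕ}
    (hi : i ≤ Fintype.card Ω) (a : Fin i → Ω) (σ : Fin (Fintype.card Ω) ≃ Ω) (k : Fin i)
    (h : ∀ j < k, σ (Fin.castLE hi j) = a j) :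
    sigmaFirst σ (Finset.univ \ (Finset.univ.filter fun j : Fin i => j < k).image a) =
      σ (Fin.castLE hi k) := by
  apply sigmaFirst_eq_of_forall_lt
  · simp only [mem_sdiff, mem_univ, true_and, mem_image, mem_filter, not_exists, not_and]
    intro j hj hjk
    rw [← h j hj] at hjk
    exact hj.ne (Fin.castLE_injective hi (σ.injective hjk))
  · intro q hq
    simp only [mem_sdiff, mem_univ, true_and, mem_image, mem_filter, not_not]
    have hqk : (q : ℕ) < k := hq
    exact ⟨⟨q, hqk.trans k.2⟩, hqk, (h ⟨q, hqk.trans k.2⟩ hqk).symm⟩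

theorem mem_omegaSet_iff [Fintype Ω] [DecidableEq Ω] [Nonempty Ω] {i : ℕ}
    (hi : i ≤ Fintype.card Ω) (a : Fin i → Ω) (σ : Fin (Fintype.card Ω) ≃ Ω) :
    σ ∈ omegaSet a ↔ ∀ k, σ (Fin.castLE hi k) = a k := by
  simp only [omegaSet, condEvent, Set.mem_iInter, Set.mem_ofPred_eq, mem_singleton]
  constructor
  · intro h k
    induction k using WellFoundedLT.induction with
    | ind k ih => rw [← sigmaFirst_sdiff_image_of_agree hi a σ k ih, h k]
  · intro h k
    rw [sigmaFirst_sdiff_image_of_agree hi a σ k fun j _ => h j, h k]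

theorem exists_equiv_extending_injective [Fintype Ω] [DecidableEq Ω] [Nonempty Ω] {i : ℕ}
    (hi : i ≤ Fintype.card Ω) (a : Fin i → Ω) (ha : Function.Injective a) :
    ∃ σ : Fin (Fintype.card Ω) ≃ Ω, ∀ k, σ (Fin.castLE hi k) = a k := by
  let f := Function.extend (Fin.castLE hi) a fun _ => Classical.arbitrary Ω
  have hf : ∀ k, f (Fin.castLE hi k) = a k := fun k =>
    (Fin.castLE_injective hi).extend_apply a _ k
  obtain ⟨g, hg⟩ := Finset.exists_equiv_extend_of_card_eq (t := (Finset.univ : Finset Ω))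
    (by simp) (s := Finset.univ.image (Fin.castLE hi)) (f := f) (Finset.subset_univ _) (by
      intro x hx y hy hxy
      obtain ⟨j, -, rfl⟩ := Finset.mem_image.mp hx
      obtain ⟨k, -, rfl⟩ := Finset.mem_image.mp hy
      rw [hf, hf] at hxy
      rw [ha hxy])
  refine ⟨g.trans (Equiv.subtypeUnivEquiv Finset.mem_univ), fun k => ?_⟩
  rw [← hf k]
  exact hg _ (Finset.mem_image_of_mem _ (Finset.mem_univ k))

theorem stmt5 [Fintype Ω] [DecidableEq Ω] [Nonempty Ω]
    (i : ℕ) (hi1 : 1 ≤ i) (hi2 : i ≤ Fintype.card Ω - 1) :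
    (∀ a : Fin i → Ω, Function.Injective a → (omegaSet a).Nonempty) ∧
    (∀ a b : Fin i → Ω, Function.Injective a → Function.Injective b → a ≠ b →
      Disjoint (omegaSet a) (omegaSet b)) ∧
    (⋃ a : {f : Fin i → Ω // Function.Injective f}, omegaSet a.1) = Set.univ := by
  have hi : i ≤ Fintype.card Ω := hi2.trans (Nat.sub_le _ _)
  refine ⟨fun a ha => ?_, fun a b _ _ hab => ?_, ?_⟩
  · obtain ⟨σ, hσ⟩ := exists_equiv_extending_injective hi a ha
    exact ⟨σ, (mem_omegaSet_iff hi a σ).mpr hσ⟩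
  · refine Set.disjoint_left.mpr fun σ h₁ h₂ => hab (funext fun k => ?_)
    rw [← (mem_omegaSet_iff hi a σ).mp h₁ k, (mem_omegaSet_iff hi b σ).mp h₂ k]
  · refine Set.eq_univ_of_forall fun σ => Set.mem_iUnion.mpr
      ⟨⟨fun k => σ (Fin.castLE hi k), σ.injective.comp (Fin.castLE_injective hi)⟩, ?_⟩
    exact (mem_omegaSet_iff hi _ σ).mpr fun _ => rfl
end

section
/- (Characterization of the order between basic conditionals.) Let A, B, C, D ⊆ Ω be events with B and D nonempty and C∩D ⊆ B. Then ⟦A∣B⟧ ⊆ ⟦C∣D⟧ if and only if ⟦C∣D⟧ equals the set of all enumerations, or ⟦A∣B⟧ = ∅, or (A∩B ⊆ C∩D and D ⊆ B). -/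
open Finset

variable {Ω : Type*}

theorem sigmaFirst_eq [Fintype Ω] [DecidableEq Ω] [Nonempty Ω]
    {σ : Fin (Fintype.card Ω) ≃ Ω} {B : Finset Ω} {i : Fin (Fintype.card Ω)}
    (hi : σ i ∈ B) (hmin : ∀ j, σ j ∈ B → i ≤ j) : sigmaFirst σ B = σ i := by
  have hne : (Finset.univ.filter fun i => σ i ∈ B).Nonempty := ⟨i, by simpa using hi⟩
  rw [sigmaFirst, dif_pos hne]
  congr 1
  apply le_antisymm
  · exact Finset.min'_le _ _ (by simpa using hi)
  · exact Finset.le_min' _ _ _ fun j hj => hmin j (by simpa using hj)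

theorem exists_first_index [Fintype Ω] [DecidableEq Ω]
    (σ : Fin (Fintype.card Ω) ≃ Ω) {B : Finset Ω} (hB : B.Nonempty) :
    ∃ i, σ i ∈ B ∧ ∀ j, σ j ∈ B → i ≤ j := by
  obtain ⟨b, hb⟩ := hB
  have hne : (Finset.univ.filter fun i => σ i ∈ B).Nonempty := ⟨σ.symm b, by simpa using hb⟩
  refine ⟨_, (Finset.mem_filter.1 (Finset.min'_mem _ hne)).2, fun j hj => ?_⟩
  exact Finset.min'_le _ _ (by simpa using hj)

theorem exists_enumeration_starting_with [Fintype Ω] [DecidableEq Ω]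
    {x y : Ω} (hxy : x ≠ y) :
    ∃ (σ : Fin (Fintype.card Ω) ≃ Ω) (i j : Fin (Fintype.card Ω)),
      σ i = x ∧ σ j = y ∧ (∀ k, i ≤ k) ∧ ∀ k, σ k ≠ x → j ≤ k := by
  have hcard : 1 < Fintype.card Ω := Fintype.one_lt_card_iff.2 ⟨x, y, hxy⟩
  let i : Fin (Fintype.card Ω) := ⟨0, by omega⟩
  let j : Fin (Fintype.card Ω) := ⟨1, hcard⟩
  have hij : i ≠ j := by simp [i, j]
  let e := (Fintype.equivFin Ω).symm
  let τ := e.trans (Equiv.swap (e i) x)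
  have hτ : τ i = x := by simp [τ]
  have hτj : x ≠ τ j := fun h => hij (τ.injective (hτ.trans h))
  have hσ : (τ.trans (Equiv.swap (τ j) y)) i = x := by
    rw [Equiv.trans_apply, hτ, Equiv.swap_apply_of_ne_of_ne hτj hxy]
  refine ⟨τ.trans (Equiv.swap (τ j) y), i, j, hσ, by simp, fun k => ?_, fun k hk => ?_⟩
  · exact Fin.le_def.2 (Nat.zero_le _)
  · have hki : k ≠ i := fun h => hk (h ▸ hσ)
    exact Fin.le_def.2 (Nat.one_le_iff_ne_zero.2 fun h => hki (Fin.ext h))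

theorem exists_sigmaFirst_eq [Fintype Ω] [DecidableEq Ω] [Nonempty Ω]
    {x y : Ω} (hxy : x ≠ y) :
    ∃ σ : Fin (Fintype.card Ω) ≃ Ω, (∀ B : Finset Ω, x ∈ B → sigmaFirst σ B = x) ∧
      ∀ B : Finset Ω, x ∉ B → y ∈ B → sigmaFirst σ B = y := by
  obtain ⟨σ, i, j, rfl, rfl, hi, hj⟩ := exists_enumeration_starting_with hxy
  exact ⟨σ, fun B hB => sigmaFirst_eq hB fun k _ => hi k,
    fun B hx hy => sigmaFirst_eq hy fun k hk => hj k fun h => hx (h ▸ hk)⟩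

theorem exists_sigmaFirst_eq_self [Fintype Ω] [DecidableEq Ω] [Nonempty Ω] (x : Ω) :
    ∃ σ : Fin (Fintype.card Ω) ≃ Ω, ∀ B : Finset Ω, x ∈ B → sigmaFirst σ B = x := by
  let e := (Fintype.equivFin Ω).symm
  let i : Fin (Fintype.card Ω) := ⟨0, Fintype.card_pos⟩
  have hi : (e.trans (Equiv.swap (e i) x)) i = x := by simp
  exact ⟨e.trans (Equiv.swap (e i) x), fun B hB =>
    (sigmaFirst_eq (hi.symm ▸ hB) fun k _ => Fin.le_def.2 (Nat.zero_le _)).trans hi⟩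

theorem stmt12 [Fintype Ω] [DecidableEq Ω] [Nonempty Ω]
    (A B C D : Finset Ω) (hB : B.Nonempty) (hD : D.Nonempty) (hCD : C ∩ D ⊆ B) :
    condEvent A B ⊆ condEvent C D ↔
      condEvent C D = (Set.univ : Set (Fin (Fintype.card Ω) ≃ Ω)) ∨
      condEvent A B = ∅ ∨
      (A ∩ B ⊆ C ∩ D ∧ D ⊆ B) := by
  constructor
  · intro hsub
    by_cases hDC : D ⊆ C
    · left
      refine Set.eq_univ_of_forall fun σ => ?_
      obtain ⟨i, hi, hmin⟩ := exists_first_index σ hD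
      change sigmaFirst σ D ∈ C
      exact sigmaFirst_eq hi hmin ▸ hDC hi
    obtain ⟨d, hdD, hdC⟩ := Finset.not_subset.1 hDC
    obtain hAB | ⟨a, ha⟩ := (A ∩ B).eq_empty_or_nonempty
    · right; left
      refine Set.eq_empty_of_forall_notMem fun σ hσ => ?_
      obtain ⟨i, hi, hmin⟩ := exists_first_index σ hB
      change sigmaFirst σ B ∈ A at hσ
      rw [sigmaFirst_eq hi hmin] at hσ
      exact Finset.notMem_empty _ (hAB ▸ Finset.mem_inter.2 ⟨hσ, hi⟩)
    right; right
    have key : ∀ σ, sigmaFirst σ B ∈ A → sigmaFirst σ D ∈ C := fun σ h => hsub h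
    constructor
    · intro z hz
      obtain ⟨hzA, hzB⟩ := Finset.mem_inter.1 hz
      by_cases hzD : z ∈ D
      · obtain ⟨σ, hσ⟩ := exists_sigmaFirst_eq_self z
        have h := key σ (by rwa [hσ B hzB])
        rw [hσ D hzD] at h
        exact Finset.mem_inter.2 ⟨h, hzD⟩
      · obtain ⟨σ, hx, hy⟩ := exists_sigmaFirst_eq (x := z) (y := d) fun h => hzD (h ▸ hdD)
        have h := key σ (by rwa [hx B hzB])
        rw [hy D hzD hdD] at h
        exact absurd h hdC
    · intro x hxD
      by_contra hxB
      obtain ⟨haA, haB⟩ := Finset.mem_inter.1 ha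
      have hxC : x ∉ C := fun h => hxB (hCD (Finset.mem_inter.2 ⟨h, hxD⟩))
      obtain ⟨σ, hx, hy⟩ := exists_sigmaFirst_eq (x := x) (y := a) fun h => hxB (h ▸ haB)
      have h := key σ (by rwa [hy B hxB haB])
      rw [hx D hxD] at h
      exact hxC h
  · rintro (h | h | ⟨hAB, hDB⟩)
    · exact h ▸ Set.subset_univ _
    · exact h ▸ Set.empty_subset _
    · intro σ hσ
      obtain ⟨i, hi, hmin⟩ := exists_first_index σ hB
      change sigmaFirst σ B ∈ A at hσ
      rw [sigmaFirst_eq hi hmin] at hσ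
      obtain ⟨hC, hDi⟩ := Finset.mem_inter.1 (hAB (Finset.mem_inter.2 ⟨hσ, hi⟩))
      change sigmaFirst σ D ∈ C
      rwa [sigmaFirst_eq hDi fun j hj => hmin j (hDB hj)]
end

section
/- (Semantic KLM rules: Cut and Cautious Monotony.) For all events A, B, C ⊆ Ω such that A∩B is nonempty (hence B is nonempty): (Cut) ⟦A∣B⟧ ∩ ⟦C∣A∩B⟧ ⊆ ⟦C∣B⟧, and (Cautious Monotony) ⟦A∣B⟧ ∩ ⟦C∣B⟧ ⊆ ⟦C∣A∩B⟧. -/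
open Finset

variable {Ω : Type*}

/-- If the `σ`-first element of `B` lies in `A`, it is also the `σ`-first element of `A ∩ B`. -/
theorem sigmaFirst_inter_of_mem [Fintype Ω] [DecidableEq Ω] [Nonempty Ω]
    {σ : Fin (Fintype.card Ω) ≃ Ω} {A B : Finset Ω} (hB : B.Nonempty)
    (hA : sigmaFirst σ B ∈ A) : sigmaFirst σ (A ∩ B) = sigmaFirst σ B := by
  have hne : (Finset.univ.filter fun i => σ i ∈ B).Nonempty := by
    obtain ⟨b, hb⟩ := hB
    exact ⟨σ.symm b, by simpa using hb⟩
  have hfirst : sigmaFirst σ B = σ ((Finset.univ.filter fun i => σ i ∈ B).min' hne) :=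
    dif_pos hne
  rw [hfirst] at hA ⊢
  have hmin := Finset.min'_mem _ hne
  have hmem : (Finset.univ.filter fun i => σ i ∈ B).min' hne ∈
      Finset.univ.filter fun i => σ i ∈ A ∩ B :=
    Finset.mem_filter.2
      ⟨Finset.mem_univ _, Finset.mem_inter.2 ⟨hA, (Finset.mem_filter.1 hmin).2⟩⟩
  rw [sigmaFirst, dif_pos ⟨_, hmem⟩]
  refine congrArg σ (le_antisymm (Finset.min'_le _ _ hmem) (Finset.min'_le _ _ ?_))
  have h := Finset.min'_mem _ ⟨_, hmem⟩
  exact Finset.mem_filter.2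
    ⟨Finset.mem_univ _, (Finset.mem_inter.1 (Finset.mem_filter.1 h).2).2⟩

theorem stmt19 [Fintype Ω] [DecidableEq Ω] [Nonempty Ω]
    (A B C : Finset Ω) (hAB : (A ∩ B).Nonempty) :
    condEvent A B ∩ condEvent C (A ∩ B) ⊆ condEvent C B ∧
    condEvent A B ∩ condEvent C B ⊆ condEvent C (A ∩ B) := by
  have hB : B.Nonempty := hAB.mono Finset.inter_subset_right
  constructor
  · rintro σ ⟨hA, hC⟩
    rwa [condEvent, Set.mem_ofPred_eq, sigmaFirst_inter_of_mem hB hA] at hC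
  · rintro σ ⟨hA, hC⟩
    rwa [condEvent, Set.mem_ofPred_eq, sigmaFirst_inter_of_mem hB hA]
end
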